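/- The torsion 3-form T of the canonical connection of n_p is invariant under the holonomy algebra spanned by H₁, H₂, H₃: for each j = 1, 2, 3 and all X, Y, Z ∈ n_p, T(HⱼX, Y, Z) + T(X, HⱼY, Z) + T(X, Y, HⱼZ) = 0. (This expresses the parallelism ∇T = 0 of the torsion of the canonical connection.) -/

import Mathlib

/-! Common setup: the quaternionic Heisenberg Lie algebra `n_p` of dimension `4p+3`,
realised as `ℝ^{4p+3}` with orthonormal basis `ξ₁ ξ₂ ξ₃ τ₁ … τ_{4p}`. -/

noncomputable section

open scoped BigOperators

/-- The underlying vector space of the quaternionic Heisenberg Lie algebra `n_p`. -/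
abbrev NV (p : ℕ) : Type := Fin (4 * p + 3) → ℝ

/-- The inner product `g_λ` for which the standard basis is orthonormal. -/
def gIP {p : ℕ} (X Y : NV p) : ℝ := ∑ a, X a * Y a

/-- Index of the basis vector `ξ_{i+1}`, `i = 0, 1, 2`. -/
def zI (p : ℕ) (i : Fin 3) : Fin (4 * p + 3) := ⟨i.val, by have := i.isLt; omega⟩

/-- Index of the basis vector `τ_{ip + r + 1}`, `i = 0, 1, 2, 3`, `r = 0, …, p-1`. -/
def tI (p : ℕ) (i : Fin 4) (r : Fin p) : Fin (4 * p + 3) :=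
  ⟨3 + i.val * p + r.val, by
    have h1 := i.isLt; have h2 := r.isLt
    have h3 : i.val * p ≤ 3 * p := Nat.mul_le_mul_right p (by omega)
    omega⟩

/-- The basis vector `ξ_{i+1}`. -/
def xi (p : ℕ) (i : Fin 3) : NV p := Pi.single (zI p i) 1

/-- The basis vector `τ_{ip + r + 1}`. -/
def tau (p : ℕ) (i : Fin 4) (r : Fin p) : NV p := Pi.single (tI p i r) 1

/-- The Lie bracket of `n_p`: the bilinear extension of
`[τ_r, τ_{p+r}] = [τ_{2p+r}, τ_{3p+r}] = λ ξ₁`, `[τ_r, τ_{2p+r}] = [τ_{3p+r}, τ_{p+r}] = λ ξ₂`,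
`[τ_r, τ_{3p+r}] = [τ_{p+r}, τ_{2p+r}] = λ ξ₃`, all other brackets of basis vectors being zero. -/
def bracket (p : ℕ) (lam : ℝ) (X Y : NV p) : NV p :=
  (lam * ∑ r : Fin p,
      (X (tI p 0 r) * Y (tI p 1 r) - X (tI p 1 r) * Y (tI p 0 r)
        + X (tI p 2 r) * Y (tI p 3 r) - X (tI p 3 r) * Y (tI p 2 r))) • xi p 0
  + (lam * ∑ r : Fin p,
      (X (tI p 0 r) * Y (tI p 2 r) - X (tI p 2 r) * Y (tI p 0 r)
        + X (tI p 3 r) * Y (tI p 1 r) - X (tI p 1 r) * Y (tI p 3 r))) • xi p 1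
  + (lam * ∑ r : Fin p,
      (X (tI p 0 r) * Y (tI p 3 r) - X (tI p 3 r) * Y (tI p 0 r)
        + X (tI p 1 r) * Y (tI p 2 r) - X (tI p 2 r) * Y (tI p 1 r))) • xi p 2

/-- `dη_i(X, Y) := -η_i([X, Y])`. -/
def dEta (p : ℕ) (lam : ℝ) (i : Fin 3) (X Y : NV p) : ℝ := -(bracket p lam X Y (zI p i))

/-- The three almost contact endomorphisms `φ₁, φ₂, φ₃` of `n_p`. -/
def phi (p : ℕ) : Fin 3 → NV p → NV p :=
  ![fun X => X (zI p 1) • xi p 2 - X (zI p 2) • xi p 1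
      + ∑ r : Fin p, (X (tI p 0 r) • tau p 1 r - X (tI p 1 r) • tau p 0 r
          + X (tI p 2 r) • tau p 3 r - X (tI p 3 r) • tau p 2 r),
    fun X => X (zI p 2) • xi p 0 - X (zI p 0) • xi p 2
      + ∑ r : Fin p, (X (tI p 0 r) • tau p 2 r - X (tI p 2 r) • tau p 0 r
          + X (tI p 3 r) • tau p 1 r - X (tI p 1 r) • tau p 3 r),
    fun X => X (zI p 0) • xi p 1 - X (zI p 1) • xi p 0
      + ∑ r : Fin p, (X (tI p 0 r) • tau p 3 r - X (tI p 3 r) • tau p 0 r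
          + X (tI p 1 r) • tau p 2 r - X (tI p 2 r) • tau p 1 r)]

/-- `(η_i ∧ η_j)(X, Y)`. -/
def etaWedge (p : ℕ) (i j : Fin 3) (X Y : NV p) : ℝ :=
  X (zI p i) * Y (zI p j) - Y (zI p i) * X (zI p j)

/-- The 2-forms `H₁ = -(1/λ)dη₁ + 2 η₂∧η₃`, `H₂ = -(1/λ)dη₂ - 2 η₁∧η₃`,
`H₃ = -(1/λ)dη₃ + 2 η₁∧η₂`. -/
def Hform (p : ℕ) (lam : ℝ) : Fin 3 → NV p → NV p → ℝ :=
  ![fun X Y => -(1 / lam) * dEta p lam 0 X Y + 2 * etaWedge p 1 2 X Y,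
    fun X Y => -(1 / lam) * dEta p lam 1 X Y - 2 * etaWedge p 0 2 X Y,
    fun X Y => -(1 / lam) * dEta p lam 2 X Y + 2 * etaWedge p 0 1 X Y]

/-- The 2-form `H_i` regarded as an endomorphism of `n_p` via `g_λ(H_i X, Y) = H_i(X, Y)`. -/
def Hend (p : ℕ) (lam : ℝ) (i : Fin 3) (X : NV p) : NV p :=
  fun b => Hform p lam i X (Pi.single b 1)

/-- `(η₁ ∧ η₂ ∧ η₃)(X, Y, Z)`. -/
def det3 (p : ℕ) (X Y Z : NV p) : ℝ :=
  X (zI p 0) * (Y (zI p 1) * Z (zI p 2) - Y (zI p 2) * Z (zI p 1))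
  - Y (zI p 0) * (X (zI p 1) * Z (zI p 2) - X (zI p 2) * Z (zI p 1))
  + Z (zI p 0) * (X (zI p 1) * Y (zI p 2) - X (zI p 2) * Y (zI p 1))

/-- The torsion 3-form `T = η₁∧dη₁ + η₂∧dη₂ + η₃∧dη₃ - 4λ η₁∧η₂∧η₃`. -/
def Tform (p : ℕ) (lam : ℝ) (X Y Z : NV p) : ℝ :=
  (∑ i : Fin 3,
    (X (zI p i) * dEta p lam i Y Z - Y (zI p i) * dEta p lam i X Z
      + Z (zI p i) * dEta p lam i X Y)) - 4 * lam * det3 p X Y Z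

/-- The standard basis vector `e_a` of `n_p`. -/
def basisE (p : ℕ) (a : Fin (4 * p + 3)) : NV p := Pi.single a 1

end

@[simp] lemma tI_ne_zI (p : ℕ) (i : Fin 4) (r : Fin p) (k : Fin 3) : tI p i r ≠ zI p k := by
  have := k.isLt
  simp only [tI, zI, ne_eq, Fin.mk.injEq]
  omega

@[simp] lemma zI_ne_tI (p : ℕ) (i : Fin 4) (r : Fin p) (k : Fin 3) : zI p k ≠ tI p i r :=
  (tI_ne_zI p i r k).symm

@[simp] lemma zI_inj (p : ℕ) (k l : Fin 3) : zI p k = zI p l ↔ k = l := by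
  simp [zI, Fin.ext_iff]

@[simp] lemma tI_inj (p : ℕ) (i j : Fin 4) (r s : Fin p) :
    tI p i r = tI p j s ↔ i = j ∧ r = s := by
  refine ⟨fun h => ?_, by rintro ⟨rfl, rfl⟩; rfl⟩
  have hr := r.isLt
  have hs := s.isLt
  simp only [tI, Fin.mk.injEq] at h
  have hij : i = j := by
    fin_cases i <;> fin_cases j <;> simp at h ⊢ <;> omega
  subst hij
  exact ⟨rfl, Fin.ext (by omega)⟩

lemma dEta_zero (p : ℕ) (lam : ℝ) (X Y : NV p) :
    dEta p lam 0 X Y = -lam * ∑ r : Fin p,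
      (X (tI p 0 r) * Y (tI p 1 r) - X (tI p 1 r) * Y (tI p 0 r)
        + X (tI p 2 r) * Y (tI p 3 r) - X (tI p 3 r) * Y (tI p 2 r)) := by
  simp [dEta, bracket, xi]

lemma dEta_one (p : ℕ) (lam : ℝ) (X Y : NV p) :
    dEta p lam 1 X Y = -lam * ∑ r : Fin p,
      (X (tI p 0 r) * Y (tI p 2 r) - X (tI p 2 r) * Y (tI p 0 r)
        + X (tI p 3 r) * Y (tI p 1 r) - X (tI p 1 r) * Y (tI p 3 r)) := by
  simp [dEta, bracket, xi]

lemma dEta_two (p : ℕ) (lam : ℝ) (X Y : NV p) :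
    dEta p lam 2 X Y = -lam * ∑ r : Fin p,
      (X (tI p 0 r) * Y (tI p 3 r) - X (tI p 3 r) * Y (tI p 0 r)
        + X (tI p 1 r) * Y (tI p 2 r) - X (tI p 2 r) * Y (tI p 1 r)) := by
  simp [dEta, bracket, xi]

/-- Horizontal coordinates of `H_{j+1}`, which acts there as left multiplication by the `j`-th
imaginary quaternion unit. -/
lemma Hend_apply_tI (p : ℕ) {lam : ℝ} (hlam : lam ≠ 0) (j : Fin 3) (i : Fin 4) (X : NV p)
    (r : Fin p) :
    Hend p lam j X (tI p i r) =
      (![![-X (tI p 1 r), X (tI p 0 r), -X (tI p 3 r), X (tI p 2 r)],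
         ![-X (tI p 2 r), X (tI p 3 r), X (tI p 0 r), -X (tI p 1 r)],
         ![-X (tI p 3 r), -X (tI p 2 r), X (tI p 1 r), X (tI p 0 r)]] :
        Fin 3 → Fin 4 → ℝ) j i := by
  fin_cases j <;> fin_cases i <;>
    simp [Hend, Hform, dEta_zero, dEta_one, dEta_two, etaWedge, Pi.single_apply, hlam]

/-- Vertical coordinates of `H_{j+1}`, which acts there as twice a rotation generator. -/
lemma Hend_apply_zI (p : ℕ) (lam : ℝ) (j k : Fin 3) (X : NV p) :
    Hend p lam j X (zI p k) =
      (![![0, -2 * X (zI p 2), 2 * X (zI p 1)],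
         ![2 * X (zI p 2), 0, -2 * X (zI p 0)],
         ![-2 * X (zI p 1), 2 * X (zI p 0), 0]] : Fin 3 → Fin 3 → ℝ) j k := by
  fin_cases j <;> fin_cases k <;>
    simp [Hend, Hform, dEta_zero, dEta_one, dEta_two, etaWedge]

/-- `H_{j+1}` acts on the triple `dη₁, dη₂, dη₃` as twice a rotation generator. -/
lemma dEta_Hend_right (p : ℕ) {lam : ℝ} (hlam : lam ≠ 0) (j k : Fin 3) (X Y : NV p) :
    dEta p lam k X (Hend p lam j Y) =
      (![![0, -2 * dEta p lam 2 X Y, 2 * dEta p lam 1 X Y],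
         ![2 * dEta p lam 2 X Y, 0, -2 * dEta p lam 0 X Y],
         ![-2 * dEta p lam 1 X Y, 2 * dEta p lam 0 X Y, 0]] : Fin 3 → Fin 3 → ℝ) j k
        - dEta p lam k (Hend p lam j X) Y := by
  rw [eq_sub_iff_add_eq]
  fin_cases j <;> fin_cases k <;>
    simp [dEta_zero, dEta_one, dEta_two, Hend_apply_tI p hlam, Finset.sum_add_distrib,
      Finset.sum_sub_distrib] <;>
    ring

/-- the torsion 3-form `T` of the canonical connection is invariant under the
holonomy algebra spanned by `H₁, H₂, H₃` (this expresses `∇T = 0`). -/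
theorem quaternionic_heisenberg_torsion_holonomy_invariant
    (p : ℕ) (hp : 1 ≤ p) (lam : ℝ) (hlam : 0 < lam) :
    ∀ j : Fin 3, ∀ X Y Z : NV p,
      Tform p lam (Hend p lam j X) Y Z + Tform p lam X (Hend p lam j Y) Z
        + Tform p lam X Y (Hend p lam j Z) = 0 := by
  intro j X Y Z
  simp only [Tform, det3, Fin.sum_univ_three, dEta_Hend_right p hlam.ne', Hend_apply_zI]
  fin_cases j <;> simp <;> ring
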